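/- arXiv:2112.04210 — 3 statements merged into one kernel-verified Lean document; each statement's English description precedes it below -/
import Mathlib

section
/- With d = deg π, the polynomial φ̄_d − 1 is irreducible in 𝔽_𝔭[U,V]. -/
open MvPolynomial

/-- The isobaric polynomials `φ_d ∈ A[U,V]` (with `A = 𝔽_q[T]`), defined by the recursion
`φ_0 = 1`, `φ_1 = U − T^q·V`, and
`φ_d = φ_{d−1}·(U − T^q·V)^{q^{d−1}} + (T^{q^{d−1}} − T)·φ_{d−2}·(U^q·V)^{q^{d−2}}` for `d ≥ 2`.
Here `U = X 0`, `V = X 1` and `T = Polynomial.X`. -/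
noncomputable def phiPoly (Fq : Type) [Field Fq] (q : ℕ) :
    ℕ → MvPolynomial (Fin 2) (Polynomial Fq)
  | 0 => 1
  | 1 => X 0 - C (Polynomial.X ^ q) * X 1
  | (d + 2) =>
      phiPoly Fq q (d + 1) * (X 0 - C (Polynomial.X ^ q) * X 1) ^ q ^ (d + 1) +
        C (Polynomial.X ^ (q ^ (d + 1)) - Polynomial.X) * phiPoly Fq q d *
          (X 0 ^ q * X 1) ^ q ^ d

/-- Dehomogenized version of the reduction of `phiPoly`. -/
noncomputable def gPoly {K : Type} [Field K] (q : ℕ) (t : K) : ℕ → Polynomial K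
  | 0 => 1
  | 1 => Polynomial.X - Polynomial.C (t ^ q)
  | (d + 2) =>
      gPoly q t (d + 1) * (Polynomial.X - Polynomial.C (t ^ q)) ^ q ^ (d + 1) +
        Polynomial.C (t ^ (q ^ (d + 1)) - t) * gPoly q t d * (Polynomial.X ^ q) ^ q ^ d

/-- The degree of `gPoly`. -/
def gDeg (q : ℕ) : ℕ → ℕ
  | 0 => 0
  | (d + 1) => gDeg q d + q ^ d

lemma gPoly_monic {K : Type} [Field K] (q : ℕ) (hq : 1 < q) (t : K) (n : ℕ) :
    ((gPoly q t n).Monic ∧ (gPoly q t n).natDegree = gDeg q n) ∧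
    ((gPoly q t (n+1)).Monic ∧ (gPoly q t (n+1)).natDegree = gDeg q (n+1)) := by
  induction n with
  | zero =>
    refine ⟨⟨by simp [gPoly], by simp [gPoly, gDeg]⟩, ⟨?_, ?_⟩⟩
    · simp only [gPoly]; exact Polynomial.monic_X_sub_C _
    · simp only [gPoly, gDeg]; rw [Polynomial.natDegree_X_sub_C]; simp
  | succ n ih =>
    refine ⟨ih.2, ?_⟩
    obtain ⟨⟨m0, d0⟩, ⟨m1, d1⟩⟩ := ih
    have hm : (gPoly q t (n + 1) *
        (Polynomial.X - Polynomial.C (t ^ q)) ^ q ^ (n + 1)).Monic :=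
      m1.mul ((Polynomial.monic_X_sub_C _).pow _)
    have hd : (gPoly q t (n + 1) *
        (Polynomial.X - Polynomial.C (t ^ q)) ^ q ^ (n + 1)).natDegree = gDeg q (n+2) := by
      rw [m1.natDegree_mul ((Polynomial.monic_X_sub_C _).pow _), d1,
        (Polynomial.monic_X_sub_C _).natDegree_pow, Polynomial.natDegree_X_sub_C]
      simp [gDeg]
    have hlt : (Polynomial.C (t ^ (q ^ (n + 1)) - t) * gPoly q t n *
        (Polynomial.X ^ q) ^ q ^ n).degree < (gPoly q t (n + 1) *
        (Polynomial.X - Polynomial.C (t ^ q)) ^ q ^ (n + 1)).degree := by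
      rw [Polynomial.degree_eq_natDegree hm.ne_zero, hd]
      refine lt_of_le_of_lt Polynomial.degree_le_natDegree ?_
      rw [Nat.cast_lt]
      refine lt_of_le_of_lt (b := gDeg q n + q ^ (n+1)) ?_ ?_
      · refine Polynomial.natDegree_mul_le.trans ?_
        refine add_le_add ((Polynomial.natDegree_C_mul_le _ _).trans d0.le) ?_
        rw [← pow_mul, Polynomial.natDegree_X_pow, pow_succ']
      · have : 0 < q ^ n := by positivity
        simp only [gDeg]; omega
    refine ⟨?_, ?_⟩
    · simp only [gPoly]; exact hm.add_of_left hlt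
    · simp only [gPoly]; rw [Polynomial.natDegree_add_eq_left_of_degree_lt hlt, hd]

lemma gPoly_eval_zero {K : Type} [Field K] (q : ℕ) (hq : 1 < q) (t : K) (ht : t ≠ 0) (n : ℕ) :
    (gPoly q t n).eval 0 ≠ 0 ∧ (gPoly q t (n+1)).eval 0 ≠ 0 := by
  have hq0 : q ≠ 0 := by omega
  induction n with
  | zero => simp [gPoly, ht]
  | succ n ih =>
    refine ⟨ih.2, ?_⟩
    have := ih.2
    simp [gPoly, ht, hq0, this]

lemma gPoly_wronskian {K : Type} [Field K] (p r q : ℕ) [CharP K p] (hp : p.Prime) (hr : 0 < r)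
    (hq : q = p ^ r) (t : K) (n : ℕ) (hc : ∀ i, 0 < i → i ≤ n → t ^ q ^ i - t ≠ 0) :
    ∃ (e : K) (m : ℕ), e ≠ 0 ∧
      gPoly q t (n+1) * (gPoly q t n).derivative - gPoly q t n * (gPoly q t (n+1)).derivative
        = Polynomial.C e * Polynomial.X ^ m := by
  have hqK : (q : K) = 0 := by
    rw [hq]; push_cast; rw [CharP.cast_eq_zero, zero_pow hr.ne']
  induction n with
  | zero => exact ⟨-1, 0, by simp, by
      simp only [gPoly, Polynomial.derivative_sub, Polynomial.derivative_C]; simp⟩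
  | succ n ih =>
    obtain ⟨e, m, he, h⟩ := ih (fun i h1 h2 => hc i h1 (by omega))
    refine ⟨-(t ^ q ^ (n+1) - t) * e, m + q * q ^ n, mul_ne_zero
      (neg_ne_zero.2 (hc _ (by omega) le_rfl)) he, ?_⟩
    have hder : (gPoly q t (n+2)).derivative = (gPoly q t (n + 1)).derivative *
        (Polynomial.X - Polynomial.C (t ^ q)) ^ q ^ (n + 1) +
        Polynomial.C (t ^ (q ^ (n + 1)) - t) * (gPoly q t n).derivative *
          (Polynomial.X ^ q) ^ q ^ n := by
      simp only [gPoly, Polynomial.derivative_add, Polynomial.derivative_mul,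
        Polynomial.derivative_C, ← pow_mul,
        Polynomial.derivative_pow, Nat.cast_mul, Nat.cast_pow, hqK, zero_mul, map_zero, mul_zero,
        add_zero, zero_add, pow_succ]
    rw [show n + 1 + 1 = n + 2 from rfl, hder]
    simp only [gPoly]
    have : ∀ (a b a' b' w c x e m : Polynomial K), b * a' - a * b' = e * m →
        (b * w + c * a * x) * b' - b * (b' * w + c * a' * x) = (-c * e) * (m * x) := by
      intro a b a' b' w c x e m h
      linear_combination (-c * x) * h
    rw [this _ _ _ _ _ _ _ _ _ h, ← pow_mul, ← pow_add, Polynomial.C_mul, Polynomial.C_neg]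

lemma gPoly_separable {K : Type} [Field K] (p r q : ℕ) [CharP K p] (hp : p.Prime) (hr : 0 < r)
    (hq : q = p ^ r) (t : K) (ht : t ≠ 0) (n : ℕ)
    (hc : ∀ i, 0 < i → i < n → t ^ q ^ i - t ≠ 0) : (gPoly q t n).Separable := by
  have hq1 : 1 < q := hq ▸ Nat.one_lt_pow hr.ne' hp.one_lt
  cases n with
  | zero => simp [gPoly, Polynomial.separable_one]
  | succ n =>
    obtain ⟨e, m, he, h⟩ := gPoly_wronskian p r q hp hr hq t n (fun i h1 h2 => hc i h1 (by omega))
    have h0 := (gPoly_eval_zero q hq1 t ht n).2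
    set g := gPoly q t (n+1)
    have hX : IsCoprime g Polynomial.X := by
      refine ((Polynomial.irreducible_X).coprime_iff_not_dvd.2 ?_).symm
      rwa [Polynomial.X_dvd_iff, Polynomial.coeff_zero_eq_eval_zero]
    have hXm : IsCoprime g (Polynomial.C e * Polynomial.X ^ m) :=
      IsCoprime.mul_right 
        ((isCoprime_one_right.of_isCoprime_of_dvd_right
          (isUnit_iff_dvd_one.1 (Polynomial.isUnit_C.2 he.isUnit)))) hX.pow_right
    rw [← h, sub_eq_add_neg, add_comm] at hXm
    have h2 := (IsCoprime.add_mul_left_right_iff (z := (gPoly q t n).derivative)).1 hXm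
    rw [← mul_neg_one, mul_assoc] at h2
    rw [Polynomial.Separable]
    rw [mul_comm, mul_assoc] at h2
    exact h2.of_mul_right_left

/-- `g V^N - 1` is irreducible in `K[x][V]`. -/
lemma irred_aux {K : Type} [Field K] (g : Polynomial K) (N : ℕ) (hN : 0 < N)
    (hg : Squarefree g) (hdeg : 0 < g.natDegree) :
    Irreducible (Polynomial.C g * Polynomial.X ^ N + Polynomial.C (-1) :
      Polynomial (Polynomial K)) := by
  have hgu : ¬ IsUnit g := fun h => hdeg.ne' (Polynomial.natDegree_eq_zero_of_isUnit h)
  have hg0 : g ≠ 0 := by rintro rfl; simp at hdeg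
  obtain ⟨h, hh, k, hk⟩ := WfDvdMonoid.exists_irreducible_factor hgu hg0
  have hE : Irreducible (Polynomial.X ^ N - Polynomial.C g : Polynomial (Polynomial K)) := by
    have hmon : (Polynomial.X ^ N - Polynomial.C g : Polynomial (Polynomial K)).Monic :=
      Polynomial.monic_X_pow_sub_C g hN.ne'
    have hdg : (Polynomial.X ^ N - Polynomial.C g : Polynomial (Polynomial K)).degree = N :=
      Polynomial.degree_X_pow_sub_C hN g
    refine Polynomial.irreducible_of_eisenstein_criterion (P := Ideal.span {h}) ?_ ?_ ?_ ?_ ?_ ?_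
    · rw [Ideal.span_singleton_prime hh.ne_zero]; exact hh.prime
    · rw [hmon.leadingCoeff, Ideal.mem_span_singleton]
      exact fun hd => hh.not_isUnit (isUnit_of_dvd_one hd)
    · intro n hn
      rw [hdg, Nat.cast_lt] at hn
      rw [Ideal.mem_span_singleton, Polynomial.coeff_sub, Polynomial.coeff_X_pow,
        if_neg hn.ne, Polynomial.coeff_C]
      split_ifs
      · exact ⟨-k, by rw [hk]; ring⟩
      · simp
    · rw [hdg]; exact_mod_cast hN
    · rw [Ideal.span_singleton_pow, Ideal.mem_span_singleton, Polynomial.coeff_sub,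
        Polynomial.coeff_X_pow, if_neg hN.ne, Polynomial.coeff_C_zero, zero_sub, dvd_neg, sq]
      exact fun hd => hh.not_isUnit (hg h hd)
    · exact hmon.isPrimitive
  have hcoeff : (Polynomial.C g * Polynomial.X ^ N + Polynomial.C (-1) :
      Polynomial (Polynomial K)).coeff 0 = -1 := by
    rw [Polynomial.coeff_add, Polynomial.coeff_C_mul, Polynomial.coeff_X_pow, if_neg hN.ne]
    simp
  have hrev : (Polynomial.C g * Polynomial.X ^ N + Polynomial.C (-1) :
      Polynomial (Polynomial K)).reverse = -(Polynomial.X ^ N - Polynomial.C g) := by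
    rw [Polynomial.reverse_add_C, Polynomial.reverse_mul_X_pow, Polynomial.reverse_C,
      Polynomial.natDegree_C_mul_X_pow _ _ hg0]
    simp; ring
  have key : ∀ A : Polynomial (Polynomial K), IsUnit (A.coeff 0) → IsUnit A.reverse →
      IsUnit A := by
    intro A hA hr
    have h1 := Polynomial.natDegree_eq_zero_of_isUnit hr
    have h2 := A.natDegree_eq_reverse_natDegree_add_natTrailingDegree
    rw [h1, Polynomial.natTrailingDegree_eq_zero.2 (Or.inr hA.ne_zero)] at h2
    rw [Polynomial.eq_C_of_natDegree_eq_zero h2]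
    exact hA.map Polynomial.C
  refine ⟨?_, ?_⟩
  · intro hu
    have := Polynomial.natDegree_eq_zero_of_isUnit hu
    rw [Polynomial.natDegree_add_C, Polynomial.natDegree_C_mul_X_pow _ _ hg0] at this
    omega
  · intro A B hAB
    have hc : A.coeff 0 * B.coeff 0 = -1 := by
      rw [← Polynomial.mul_coeff_zero, ← hAB, hcoeff]
    have hu : IsUnit (A.coeff 0 * B.coeff 0) := by rw [hc]; exact isUnit_one.neg
    have hR : -(Polynomial.X ^ N - Polynomial.C g) = A.reverse * B.reverse := by
      rw [← Polynomial.reverse_mul_of_domain, ← hAB, hrev]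
    have hE2 : Irreducible (-(Polynomial.X ^ N - Polynomial.C g) :
      Polynomial (Polynomial K)) := (Associated.neg_left (Associated.refl _)).irreducible_iff.2 hE
    rcases hE2.isUnit_or_isUnit hR with h | h
    · exact Or.inl (key A (isUnit_of_mul_isUnit_left hu) h)
    · exact Or.inr (key B (isUnit_of_mul_isUnit_right hu) h)

/-- The substitution `U ↦ x V`, `V ↦ V`. -/
noncomputable def sigmaHom (K : Type) [Field K] :
    MvPolynomial (Fin 2) K →+* Polynomial (Polynomial K) :=
  MvPolynomial.eval₂Hom (Polynomial.C.comp Polynomial.C)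
    ![Polynomial.C Polynomial.X * Polynomial.X, Polynomial.X]

lemma sigmaHom_injective (K : Type) [Field K] : Function.Injective (sigmaHom K) := by
  let L := FractionRing (MvPolynomial (Fin 2) K)
  let ι : MvPolynomial (Fin 2) K →+* L := algebraMap _ L
  have hι : Function.Injective ι := IsFractionRing.injective _ _
  have hV : ι (X 1) ≠ 0 := by
    rw [Ne, map_eq_zero_iff ι hι]; exact MvPolynomial.X_ne_zero 1
  let τ : Polynomial (Polynomial K) →+* L :=
    Polynomial.eval₂RingHom (Polynomial.eval₂RingHom (ι.comp MvPolynomial.C) (ι (X 0) / ι (X 1)))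
      (ι (X 1))
  have hcomp : τ.comp (sigmaHom K) = ι := by
    apply MvPolynomial.ringHom_ext
    · intro a; simp [τ, sigmaHom]
    · intro i
      fin_cases i
      · simpa [τ, sigmaHom] using div_mul_cancel₀ _ hV
      · simp [τ, sigmaHom]
  have : Function.Injective (τ.comp (sigmaHom K)) := by rw [hcomp]; exact hι
  exact Function.Injective.of_comp (f := τ) this

lemma irreducible_of_sigmaHom {K : Type} [Field K] (f : MvPolynomial (Fin 2) K)
    (h : Irreducible (sigmaHom K f)) : Irreducible f := by
  have key : ∀ A, IsUnit (sigmaHom K A) → IsUnit A := by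
    intro A hA
    obtain ⟨b, hb, hb2⟩ := Polynomial.isUnit_iff.1 hA
    obtain ⟨a, ha, ha2⟩ := Polynomial.isUnit_iff.1 hb
    have : sigmaHom K (MvPolynomial.C a) = sigmaHom K A := by
      rw [← hb2, ← ha2]; simp [sigmaHom]
    rw [← sigmaHom_injective K this]
    exact ha.map MvPolynomial.C
  refine ⟨fun hu => h.not_isUnit (hu.map _), fun A B hAB => ?_⟩
  rw [hAB, map_mul] at h
  rcases h.isUnit_or_isUnit rfl with h | h
  · exact Or.inl (key _ h)
  · exact Or.inr (key _ h)

lemma sigmaHom_phi {Fq : Type} [Field Fq] (q : ℕ) {K : Type} [Field K]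
    (μ : Polynomial Fq →+* K) (n : ℕ) :
    sigmaHom K (MvPolynomial.map μ (phiPoly Fq q n)) =
      Polynomial.C (gPoly q (μ Polynomial.X) n) * Polynomial.X ^ gDeg q n ∧
    sigmaHom K (MvPolynomial.map μ (phiPoly Fq q (n+1))) =
      Polynomial.C (gPoly q (μ Polynomial.X) (n+1)) * Polynomial.X ^ gDeg q (n+1) := by
  have hU : sigmaHom K (X 0) = Polynomial.C Polynomial.X * Polynomial.X := by simp [sigmaHom]
  have hV : sigmaHom K (X 1) = Polynomial.X := by simp [sigmaHom]
  have hC : ∀ a, sigmaHom K (MvPolynomial.C a) = Polynomial.C (Polynomial.C a) := by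
    intro a; simp [sigmaHom]
  induction n with
  | zero =>
    refine ⟨by simp [phiPoly, gPoly, gDeg], ?_⟩
    simp only [phiPoly, gPoly, gDeg, map_sub, map_mul, map_pow, MvPolynomial.map_X,
      MvPolynomial.map_C, hU, hV, hC]
    ring
  | succ n ih =>
    refine ⟨ih.2, ?_⟩
    simp only [phiPoly, gPoly, map_add, map_sub, map_mul, map_pow, MvPolynomial.map_X,
      MvPolynomial.map_C, hU, hV, hC, ih.1, ih.2]
    simp only [gDeg]
    rw [← sub_mul, mul_pow, mul_pow, mul_pow, mul_pow, ← pow_mul, ← pow_mul]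
    ring

/-- With `d = deg π` (where `π ∈ A = 𝔽_q[T]` is monic irreducible, `π ≠ T`, `𝔭 = (π)`),
the polynomial `φ̄_d − 1` is irreducible in `𝔽_𝔭[U,V]`. -/
theorem phiPoly_mod_sub_one_irreducible (p r q : ℕ) (hp : p.Prime) (hodd : Odd p) (hr : 0 < r)
    (hq : q = p ^ r) (Fq : Type) [Field Fq] [Fintype Fq] (hcard : Fintype.card Fq = q)
    (π : Polynomial Fq) (hmonic : π.Monic) (hirr : Irreducible π)
    (hne : π ≠ Polynomial.X) :
    Irreducible
      (MvPolynomial.map (Ideal.Quotient.mk (Ideal.span {π})) (phiPoly Fq q π.natDegree)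
        - 1) := by
  have hq1 : 1 < q := hq ▸ Nat.one_lt_pow hr.ne' hp.one_lt
  have hmax : (Ideal.span {π}).IsMaximal := PrincipalIdealRing.isMaximal_of_irreducible hirr
  let _ : Field (Polynomial Fq ⧸ Ideal.span {π}) := Ideal.Quotient.field _
  have hd : 0 < π.natDegree := hirr.natDegree_pos
  have : Fact p.Prime := ⟨hp⟩
  have hchar : CharP Fq p := charP_of_card_eq_prime_pow (hcard.trans hq)
  let μ : Polynomial Fq →+* Polynomial Fq ⧸ Ideal.span {π} := Ideal.Quotient.mk _
  have hcharK : CharP (Polynomial Fq ⧸ Ideal.span {π}) p :=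
    charP_of_injective_ringHom (f := μ.comp Polynomial.C) (RingHom.injective _) p
  have ht : μ Polynomial.X ≠ 0 := by
    intro h
    have h2 := Ideal.mem_span_singleton.1 (Ideal.Quotient.eq_zero_iff_mem.1 h)
    exact hne (Polynomial.eq_of_monic_of_associated hmonic Polynomial.monic_X
      (hirr.associated_of_dvd Polynomial.irreducible_X h2))
  have hc : ∀ i, 0 < i → i < π.natDegree →
      (μ Polynomial.X) ^ q ^ i - μ Polynomial.X ≠ 0 := by
    intro i h1 h2 h
    rw [← map_pow, ← map_sub] at h
    have h3 := Ideal.mem_span_singleton.1 (Ideal.Quotient.eq_zero_iff_mem.1 h)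
    rw [← hcard, ← Nat.card_eq_fintype_card] at h3
    have h4 := hirr.natDegree_dvd_of_dvd_X_pow_card_pow_sub_X h3
    exact absurd (Nat.le_of_dvd h1 h4) (by omega)
  have hsep := gPoly_separable p r q hp hr hq (μ Polynomial.X) ht π.natDegree hc
  have hNpos : 0 < gDeg q π.natDegree := by
    obtain ⟨k, hk⟩ := Nat.exists_eq_succ_of_ne_zero hd.ne'
    rw [hk]
    have : 0 < q ^ k := by positivity
    simp only [gDeg]; omega
  have hdeg := (gPoly_monic q hq1 (μ Polynomial.X) π.natDegree).1.2
  have hI := irred_aux _ (gDeg q π.natDegree) hNpos hsep.squarefree (by rw [hdeg]; exact hNpos)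
  apply irreducible_of_sigmaHom
  rw [map_sub, map_one, (sigmaHom_phi q μ π.natDegree).1]
  simpa [sub_eq_add_neg] using hI
end

section
/- With d = deg π, the ideal of 𝔽_𝔭[U,V] generated by φ̄_d − 1 is a prime ideal; equivalently, the quotient ring 𝔽_𝔭[U,V]/(φ̄_d − 1) is an integral domain. -/
open MvPolynomial

/-- Dehomogenized recursion, over a field `k`, with `t` the image of `T`. -/
noncomputable def fPoly {k : Type} [Field k] (t : k) (q : ℕ) : ℕ → Polynomial k
  | 0 => 1
  | 1 => Polynomial.X - Polynomial.C (t ^ q)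
  | (d + 2) =>
      fPoly t q (d + 1) * (Polynomial.X - Polynomial.C (t ^ q)) ^ q ^ (d + 1) +
        Polynomial.C (t ^ (q ^ (d + 1)) - t) * fPoly t q d * Polynomial.X ^ q ^ (d + 1)

/-- The degree `1 + q + ⋯ + q^(d-1)`. -/
def nDeg (q : ℕ) : ℕ → ℕ
  | 0 => 0
  | (d + 1) => nDeg q d + q ^ d

theorem fPoly_monic {k : Type} [Field k] (t : k) (q : ℕ) (hq : 0 < q) (d : ℕ) :
    ((fPoly t q d).Monic ∧ (fPoly t q d).natDegree = nDeg q d) ∧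
    ((fPoly t q (d + 1)).Monic ∧ (fPoly t q (d + 1)).natDegree = nDeg q (d + 1)) := by
  induction d with
  | zero =>
    refine ⟨⟨by simp [fPoly], by simp [fPoly, nDeg]⟩, ?_, ?_⟩
    · simpa [fPoly] using Polynomial.monic_X_sub_C (t ^ q)
    · simpa [fPoly, nDeg] using Polynomial.natDegree_X_sub_C (t ^ q)
  | succ d ih =>
    refine ⟨ih.2, ?_⟩
    have hm : (fPoly t q (d + 1) *
        (Polynomial.X - Polynomial.C (t ^ q)) ^ q ^ (d + 1)).Monic :=
      ih.2.1.mul ((Polynomial.monic_X_sub_C _).pow _)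
    have hdeg : (fPoly t q (d + 1) *
        (Polynomial.X - Polynomial.C (t ^ q)) ^ q ^ (d + 1)).natDegree = nDeg q (d + 2) := by
      rw [ih.2.1.natDegree_mul ((Polynomial.monic_X_sub_C _).pow _), ih.2.2,
        (Polynomial.monic_X_sub_C _).natDegree_pow, Polynomial.natDegree_X_sub_C, mul_one]
      rfl
    have hle : (Polynomial.C (t ^ (q ^ (d + 1)) - t) * fPoly t q d *
        Polynomial.X ^ q ^ (d + 1)).natDegree ≤ nDeg q d + q ^ (d + 1) := by
      refine Polynomial.natDegree_mul_le.trans ?_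
      rw [Polynomial.natDegree_X_pow]
      refine Nat.add_le_add_right ((Polynomial.natDegree_C_mul_le _ _).trans ih.1.2.le) _
    have hlt : (Polynomial.C (t ^ (q ^ (d + 1)) - t) * fPoly t q d *
        Polynomial.X ^ q ^ (d + 1)).natDegree < (fPoly t q (d + 1) *
        (Polynomial.X - Polynomial.C (t ^ q)) ^ q ^ (d + 1)).natDegree := by
      rw [hdeg]
      refine lt_of_le_of_lt hle ?_
      have : 0 < q ^ d := by positivity
      simp only [nDeg]
      omega
    have hlt' := Polynomial.degree_lt_degree hlt
    constructor
    · simpa only [fPoly] using hm.add_of_left hlt'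
    · rw [← hdeg]
      simpa only [fPoly] using Polynomial.natDegree_add_eq_left_of_degree_lt hlt'

theorem fPoly_eval_zero {k : Type} [Field k] (t : k) (ht : t ≠ 0) (q : ℕ) (hq : 0 < q) (d : ℕ) :
    (fPoly t q d).eval 0 ≠ 0 ∧ (fPoly t q (d + 1)).eval 0 ≠ 0 := by
  induction d with
  | zero => simp [fPoly, ht]
  | succ d ih =>
    refine ⟨ih.2, ?_⟩
    simp [fPoly, ih.2, ht, hq.ne']

theorem fPoly_derivative {k : Type} [Field k] (t : k) (q : ℕ) (hqk : (q : k) = 0) (d : ℕ) :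
    Polynomial.derivative (fPoly t q (d + 2)) =
      Polynomial.derivative (fPoly t q (d + 1)) *
        (Polynomial.X - Polynomial.C (t ^ q)) ^ q ^ (d + 1) +
      Polynomial.C (t ^ (q ^ (d + 1)) - t) * Polynomial.derivative (fPoly t q d) *
        Polynomial.X ^ q ^ (d + 1) := by
  have h1 : ∀ g : Polynomial k, Polynomial.derivative (g ^ q ^ (d + 1)) = 0 := by
    intro g
    rw [Polynomial.derivative_pow]
    simp [hqk]
  simp only [fPoly, Polynomial.derivative_add, Polynomial.derivative_mul, h1,
    Polynomial.derivative_C]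
  ring

theorem fPoly_casorati {k : Type} [Field k] (t : k) (q : ℕ) (hqk : (q : k) = 0) (d : ℕ)
    (h : ∀ i, 0 < i → i < d + 1 → t ^ q ^ i - t ≠ 0) :
    ∃ c : k, ∃ m : ℕ, c ≠ 0 ∧
      fPoly t q (d + 1) * Polynomial.derivative (fPoly t q d) -
        fPoly t q d * Polynomial.derivative (fPoly t q (d + 1)) =
        Polynomial.C c * Polynomial.X ^ m := by
  induction d with
  | zero => exact ⟨-1, 0, by simp, by
      simp [fPoly, -Polynomial.C_pow, -map_pow]⟩
  | succ d ih =>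
    obtain ⟨c, m, hc, e⟩ := ih (fun i hi hi' => h i hi (by omega))
    refine ⟨-(t ^ q ^ (d + 1) - t) * c, q ^ (d + 1) + m,
      mul_ne_zero (neg_ne_zero.mpr (h _ (by omega) (by omega))) hc, ?_⟩
    rw [fPoly_derivative t q hqk]
    have e2 : Polynomial.C (-(t ^ q ^ (d + 1) - t) * c) * Polynomial.X ^ (q ^ (d + 1) + m) =
      -(Polynomial.C (t ^ q ^ (d + 1) - t)) * Polynomial.X ^ (q ^ (d + 1)) *
        (Polynomial.C c * Polynomial.X ^ m) := by
      rw [Polynomial.C_mul, Polynomial.C_neg, pow_add]; ring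
    rw [e2, ← e]
    simp only [fPoly]
    ring

theorem fPoly_separable {k : Type} [Field k] (t : k) (ht : t ≠ 0) (q : ℕ) (hq : 0 < q)
    (hqk : (q : k) = 0) (d : ℕ) (h : ∀ i, 0 < i → i < d + 1 → t ^ q ^ i - t ≠ 0) :
    (fPoly t q (d + 1)).Separable := by
  obtain ⟨c, m, hc, e⟩ := fPoly_casorati t q hqk d h
  have hX : IsCoprime (fPoly t q (d + 1)) Polynomial.X := by
    refine IsCoprime.symm ?_
    rw [Polynomial.irreducible_X.coprime_iff_not_dvd, Polynomial.X_dvd_iff,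
      Polynomial.coeff_zero_eq_eval_zero]
    exact (fPoly_eval_zero t ht q hq d).2
  have hC : IsCoprime (fPoly t q (d + 1)) (Polynomial.C c) :=
    ⟨0, Polynomial.C c⁻¹, by rw [← Polynomial.C_mul, inv_mul_cancel₀ hc]; simp⟩
  have h2 := hC.mul_right (hX.pow_right (n := m))
  rw [← e] at h2
  have h3 : IsCoprime (fPoly t q (d + 1))
      ((-fPoly t q d) * Polynomial.derivative (fPoly t q (d + 1))) := by
    have h4 := h2.add_mul_left_right (-Polynomial.derivative (fPoly t q d))
    have e5 : (-fPoly t q d) * Polynomial.derivative (fPoly t q (d + 1)) =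
        fPoly t q (d + 1) * Polynomial.derivative (fPoly t q d) -
        fPoly t q d * Polynomial.derivative (fPoly t q (d + 1)) +
        fPoly t q (d + 1) * (-Polynomial.derivative (fPoly t q d)) := by ring
    rw [e5]
    exact h4
  exact h3.of_mul_right_right

/-- Eisenstein, in the form needed. -/
theorem isUnit_of_mul_eq {k : Type} [Field k] (f : Polynomial k) (hf : Squarefree f)
    (hfu : ¬ IsUnit f) (n : ℕ) (hn : 0 < n) (G H : Polynomial (Polynomial k))
    (h : G * H = Polynomial.C f * Polynomial.X ^ n - 1) : IsUnit G ∨ IsUnit H := by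
  have hf0 : f ≠ 0 := hf.ne_zero
  obtain ⟨l, hl, hlf⟩ := WfDvdMonoid.exists_irreducible_factor hfu hf0
  have hlp : Prime l := hl.prime
  -- the polynomial `X^n - f` is irreducible
  have hirr : Irreducible (Polynomial.X ^ n - Polynomial.C f : Polynomial (Polynomial k)) := by
    have hmon := Polynomial.monic_X_pow_sub_C f hn.ne'
    have hdeg : (Polynomial.X ^ n - Polynomial.C f : Polynomial (Polynomial k)).degree = n :=
      Polynomial.degree_X_pow_sub_C hn f
    refine Polynomial.irreducible_of_eisenstein_criterion (P := Ideal.span {l})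
      ((Ideal.span_singleton_prime hlp.ne_zero).mpr hlp) ?_ ?_ ?_ ?_ hmon.isPrimitive
    · rw [hmon.leadingCoeff, Ideal.mem_span_singleton]
      exact fun h => hl.not_isUnit (isUnit_of_dvd_one h)
    · intro i hi
      rw [hdeg] at hi
      have hi' : i ≠ n := (Nat.cast_lt.mp hi).ne
      rw [Polynomial.coeff_sub, Polynomial.coeff_X_pow, if_neg hi', Polynomial.coeff_C,
        Ideal.mem_span_singleton]
      split_ifs
      · simpa using hlf
      · simp
    · rw [hdeg]; exact_mod_cast hn
    · rw [Ideal.span_singleton_pow, Ideal.mem_span_singleton, Polynomial.coeff_sub,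
        Polynomial.coeff_X_pow, if_neg hn.ne, Polynomial.coeff_C_zero, zero_sub, dvd_neg, pow_two]
      exact fun h => hl.not_isUnit (hf l h)
  have hnd : (Polynomial.C f * Polynomial.X ^ n - 1 : Polynomial (Polynomial k)).natDegree = n := by
    have := Polynomial.natDegree_sub_C (p := Polynomial.C f * Polynomial.X ^ n) (a := 1)
    rw [Polynomial.C_1] at this
    rw [this, Polynomial.natDegree_C_mul_X_pow n f hf0]
  have hrev : (Polynomial.C f * Polynomial.X ^ n - 1 : Polynomial (Polynomial k)).reverse =
      -(Polynomial.X ^ n - Polynomial.C f) := by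
    rw [Polynomial.reverse, hnd, Polynomial.reflect_sub, Polynomial.reflect_C_mul_X_pow,
      Polynomial.reflect_one, Polynomial.revAt_le le_rfl]
    simp
  have hprod : G.reverse * H.reverse = -(Polynomial.X ^ n - Polynomial.C f) := by
    rw [← Polynomial.reverse_mul_of_domain, h, hrev]
  have h0 : G.coeff 0 * H.coeff 0 = -1 := by
    rw [← Polynomial.mul_coeff_zero, h]
    simp [hn.ne]
  have hG0 : IsUnit (G.coeff 0) := IsUnit.of_mul_eq_one (-H.coeff 0) (by rw [mul_neg, h0, neg_neg])
  have hH0 : IsUnit (H.coeff 0) := IsUnit.of_mul_eq_one (-G.coeff 0)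
    (by rw [mul_neg, mul_comm, h0, neg_neg])
  have key : ∀ K : Polynomial (Polynomial k), IsUnit (K.coeff 0) → IsUnit K.reverse → IsUnit K := by
    intro K hK hu
    have h1 := Polynomial.natDegree_eq_zero_of_isUnit hu
    have h2 : K.natTrailingDegree = 0 :=
      Polynomial.natTrailingDegree_eq_zero.mpr (Or.inr hK.ne_zero)
    rw [Polynomial.reverse_natDegree, h2, Nat.sub_zero] at h1
    rw [Polynomial.eq_C_of_natDegree_eq_zero h1]
    exact Polynomial.isUnit_C.mpr hK
  have hirr' : Irreducible (-(Polynomial.X ^ n - Polynomial.C f) : Polynomial (Polynomial k)) :=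
    (Associated.refl _).neg_right.irreducible hirr
  rcases hirr'.isUnit_or_isUnit hprod.symm with hu | hu
  · exact Or.inl (key G hG0 hu)
  · exact Or.inr (key H hH0 hu)

/-- The substitution `U ↦ u w`, `V ↦ w`. -/
noncomputable def thetaHom (k : Type) [Field k] :
    MvPolynomial (Fin 2) k →+* Polynomial (Polynomial k) :=
  eval₂Hom (Polynomial.C.comp Polynomial.C) ![Polynomial.C Polynomial.X * Polynomial.X,
    Polynomial.X]

theorem thetaHom_coeff {k : Type} [Field k] (G : MvPolynomial (Fin 2) k) (m : Fin 2 →₀ ℕ) :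
    ((thetaHom k G).coeff (m 0 + m 1)).coeff (m 0) = G.coeff m := by
  induction G using MvPolynomial.induction_on' with
  | monomial e a =>
    have : thetaHom k (monomial e a) = Polynomial.C (Polynomial.C a * Polynomial.X ^ (e 0)) *
        Polynomial.X ^ (e 0 + e 1) := by
      rw [thetaHom, coe_eval₂Hom, eval₂_monomial, Finsupp.prod_fintype _ _ (by simp)]
      simp [Fin.prod_univ_two, mul_pow, pow_add]
      ring
    rw [this, Polynomial.coeff_C_mul_X_pow, coeff_monomial]
    by_cases hem : e = m
    · subst hem; simp
    · rw [if_neg hem]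
      split_ifs with h1
      · rw [Polynomial.coeff_C_mul_X_pow, if_neg]
        intro h2
        apply hem
        ext i
        fin_cases i
        · exact h2.symm
        · change e 1 = m 1
          omega
      · simp
  | add p q hp hq => simp [hp, hq]

theorem isUnit_of_thetaHom {k : Type} [Field k] (G : MvPolynomial (Fin 2) k)
    (h : IsUnit (thetaHom k G)) : IsUnit G := by
  obtain ⟨g, hg, e⟩ := Polynomial.isUnit_iff.mp h
  obtain ⟨c, hc, rfl⟩ := Polynomial.isUnit_iff.mp hg
  have : G = C c := by
    ext m
    rw [← thetaHom_coeff, ← e, coeff_C, Polynomial.coeff_C]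
    split_ifs with h1 h2 h2
    · subst h2; simp
    · exfalso
      apply h2
      ext i
      fin_cases i
      · change 0 = m 0
        omega
      · change 0 = m 1
        omega
    · subst h2; simp at h1
    · simp
  rw [this]
  exact hc.map C

theorem thetaHom_phi {k Fq : Type} [Field k] [Field Fq] (ρ : Polynomial Fq →+* k) (q d : ℕ) :
    (thetaHom k (MvPolynomial.map ρ (phiPoly Fq q d)) =
      Polynomial.C (fPoly (ρ Polynomial.X) q d) * Polynomial.X ^ nDeg q d) ∧
    (thetaHom k (MvPolynomial.map ρ (phiPoly Fq q (d + 1))) =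
      Polynomial.C (fPoly (ρ Polynomial.X) q (d + 1)) * Polynomial.X ^ nDeg q (d + 1)) := by
  have hU : thetaHom k (X 0) = Polynomial.C Polynomial.X * Polynomial.X := by simp [thetaHom]
  have hV : thetaHom k (X 1) = Polynomial.X := by simp [thetaHom]
  have hC : ∀ a, thetaHom k (C a) = Polynomial.C (Polynomial.C a) := by simp [thetaHom]
  induction d with
  | zero =>
    refine ⟨by simp [phiPoly, fPoly, nDeg], ?_⟩
    simp only [phiPoly, fPoly, nDeg, map_sub, map_mul, MvPolynomial.map_X, MvPolynomial.map_C,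
      hU, hV, hC, map_pow]
    ring
  | succ d ih =>
    refine ⟨ih.2, ?_⟩
    simp only [phiPoly, fPoly, map_add, map_sub, map_mul, MvPolynomial.map_X, MvPolynomial.map_C,
      hU, hV, hC, map_pow] at ih ⊢
    rw [ih.1, ih.2]
    have e1 : (Polynomial.C Polynomial.X * Polynomial.X -
        Polynomial.C (Polynomial.C (ρ Polynomial.X)) ^ q * Polynomial.X :
          Polynomial (Polynomial k)) =
        (Polynomial.C Polynomial.X - Polynomial.C (Polynomial.C (ρ Polynomial.X)) ^ q) *
          Polynomial.X := by ring
    rw [e1]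
    simp only [nDeg, mul_pow, pow_add, ← pow_mul, pow_succ]
    ring

theorem isPrime_of_field {k Fq : Type} [Field k] [Field Fq] (ρ : Polynomial Fq →+* k) (q d : ℕ)
    (hq : 0 < q) (hqk : (q : k) = 0) (ht : ρ Polynomial.X ≠ 0)
    (h : ∀ i, 0 < i → i < d + 1 → ρ (Polynomial.X ^ q ^ i - Polynomial.X) ≠ 0) :
    (Ideal.span {MvPolynomial.map ρ (phiPoly Fq q (d + 1)) - 1}).IsPrime := by
  have hsep := fPoly_separable (ρ Polynomial.X) ht q hq hqk d
    (fun i hi hi' => by simpa using h i hi hi')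
  have hmon := (fPoly_monic (ρ Polynomial.X) q hq d).2
  have hn : 0 < nDeg q (d + 1) := by
    have : 0 < q ^ d := by positivity
    simp only [nDeg]; omega
  have hnu : ¬ IsUnit (fPoly (ρ Polynomial.X) q (d + 1)) := by
    intro hu
    have := Polynomial.natDegree_eq_zero_of_isUnit hu
    omega
  have hθ : thetaHom k (MvPolynomial.map ρ (phiPoly Fq q (d + 1)) - 1) =
      Polynomial.C (fPoly (ρ Polynomial.X) q (d + 1)) * Polynomial.X ^ nDeg q (d + 1) - 1 := by
    rw [map_sub, map_one, (thetaHom_phi ρ q d).2]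
  have hnot : ¬ IsUnit (Polynomial.C (fPoly (ρ Polynomial.X) q (d + 1)) *
      Polynomial.X ^ nDeg q (d + 1) - 1 : Polynomial (Polynomial k)) := by
    intro hu
    have h1 := Polynomial.natDegree_eq_zero_of_isUnit hu
    have h2 := Polynomial.natDegree_sub_C (p := Polynomial.C (fPoly (ρ Polynomial.X) q (d + 1)) *
      Polynomial.X ^ nDeg q (d + 1)) (a := 1)
    rw [Polynomial.C_1, h1, Polynomial.natDegree_C_mul_X_pow _ _ hmon.1.ne_zero] at h2
    omega
  have hirr : Irreducible (MvPolynomial.map ρ (phiPoly Fq q (d + 1)) - 1) := by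
    refine ⟨fun hu => hnot (hθ ▸ hu.map (thetaHom k)), ?_⟩
    intro G H hGH
    have h3 := hθ
    rw [hGH, map_mul] at h3
    exact (isUnit_of_mul_eq _ hsep.squarefree hnu _ hn _ _ h3).imp
      (isUnit_of_thetaHom G) (isUnit_of_thetaHom H)
  exact (Ideal.span_singleton_prime hirr.ne_zero).mpr hirr.prime

/-- With `d = deg π`, the ideal of `𝔽_𝔭[U,V]` generated by `φ̄_d − 1` is prime; equivalently,
`𝔽_𝔭[U,V]/(φ̄_d − 1)` is an integral domain. -/
theorem span_phiPoly_mod_sub_one_isPrime (p r q : ℕ) (hp : p.Prime) (hodd : Odd p) (hr : 0 < r)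
    (hq : q = p ^ r) (Fq : Type) [Field Fq] [Fintype Fq] (hcard : Fintype.card Fq = q)
    (π : Polynomial Fq) (hmonic : π.Monic) (hirr : Irreducible π)
    (hne : π ≠ Polynomial.X) :
    (Ideal.span
      {MvPolynomial.map (Ideal.Quotient.mk (Ideal.span {π})) (phiPoly Fq q π.natDegree)
        - 1}).IsPrime := by
  haveI : (Ideal.span {π}).IsMaximal :=
    PrincipalIdealRing.isMaximal_of_irreducible hirr
  letI := Ideal.Quotient.field (Ideal.span {π})
  have hq0 : 0 < q := hcard ▸ Fintype.card_pos
  have hqF : (q : Fq) = 0 := by rw [← hcard]; exact FiniteField.cast_card_eq_zero Fq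
  obtain ⟨d, hd⟩ : ∃ d, π.natDegree = d + 1 :=
    Nat.exists_eq_succ_of_ne_zero hirr.natDegree_pos.ne'
  rw [hd]
  refine isPrime_of_field (Ideal.Quotient.mk (Ideal.span {π})) q d hq0 ?_ ?_ ?_
  · have := congrArg (fun x => Ideal.Quotient.mk (Ideal.span {π}) (Polynomial.C x)) hqF
    simpa using this
  · rw [Ne, Ideal.Quotient.eq_zero_iff_mem, Ideal.mem_span_singleton]
    intro hdvd
    exact hne (Polynomial.eq_of_monic_of_associated hmonic Polynomial.monic_X
      (hirr.associated_of_dvd Polynomial.irreducible_X hdvd))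
  · intro i hi hi'
    rw [Ne, Ideal.Quotient.eq_zero_iff_mem, Ideal.mem_span_singleton]
    intro hdvd
    rw [← hcard, Fintype.card_eq_nat_card] at hdvd
    have := Nat.le_of_dvd hi (hirr.natDegree_dvd_of_dvd_X_pow_card_pow_sub_X hdvd)
    omega
end

section
/- Let F be a field and let φ ∈ F[U,V] be a homogeneous polynomial of degree ≥ 1 that is square-free. Then φ − 1 is irreducible in F[U,V]. -/
open MvPolynomial

lemma irreducible_C_mul_X_pow_sub_one {A : Type*} [CommRing A] [IsDomain A] (a p : A)
    (hp : Prime p) (hpa : p ∣ a) (hpp : ¬ p * p ∣ a) (D : ℕ) (hD : 1 ≤ D) :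
    Irreducible (Polynomial.C a * Polynomial.X ^ D - 1 : Polynomial A) := by
  have ha : a ≠ 0 := fun h => hpp (h ▸ dvd_zero _)
  have hE : Irreducible (Polynomial.X ^ D - Polynomial.C a : Polynomial A) := by
    have hm : (Polynomial.X ^ D - Polynomial.C a : Polynomial A).Monic :=
      Polynomial.monic_X_pow_sub_C a (by omega)
    have hdeg : (Polynomial.X ^ D - Polynomial.C a : Polynomial A).degree = D :=
      Polynomial.degree_X_pow_sub_C (by omega) a
    have hP : (Ideal.span {p}).IsPrime := (Ideal.span_singleton_prime hp.ne_zero).2 hp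
    refine Polynomial.irreducible_of_eisenstein_criterion hP ?_ ?_ ?_ ?_ hm.isPrimitive
    · rw [hm.leadingCoeff]
      exact fun h => hP.ne_top ((Ideal.eq_top_iff_one _).2 h)
    · intro n hn
      rw [hdeg] at hn
      have hn' : n < D := by exact_mod_cast hn
      rw [Ideal.mem_span_singleton, Polynomial.coeff_sub, Polynomial.coeff_X_pow,
        if_neg hn'.ne, Polynomial.coeff_C, zero_sub, dvd_neg]
      split_ifs
      · exact hpa
      · exact dvd_zero _
    · rw [hdeg]; exact_mod_cast hD
    · rw [Ideal.span_singleton_pow, Ideal.mem_span_singleton, Polynomial.coeff_sub,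
        Polynomial.coeff_X_pow, if_neg (by omega), Polynomial.coeff_C_zero, zero_sub, dvd_neg,
        pow_two]
      exact hpp
  have hnd : (Polynomial.C a * Polynomial.X ^ D - 1 : Polynomial A).natDegree = D := by
    rw [← Polynomial.C_1, Polynomial.natDegree_sub_C, Polynomial.natDegree_C_mul_X_pow _ _ ha]
  have hrev : (Polynomial.C a * Polynomial.X ^ D - 1 : Polynomial A).reverse
      = -(Polynomial.X ^ D - Polynomial.C a) := by
    rw [Polynomial.reverse, hnd, Polynomial.reflect_sub, Polynomial.reflect_C_mul_X_pow,
      Polynomial.reflect_one, Polynomial.revAt_le le_rfl]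
    simp
  have hE' : Irreducible (Polynomial.C a * Polynomial.X ^ D - 1 : Polynomial A).reverse := by
    rw [hrev]
    exact (Associated.neg_right (Associated.refl _)).irreducible hE
  have key : ∀ g h : Polynomial A, Polynomial.C a * Polynomial.X ^ D - 1 = g * h →
      IsUnit g.reverse → IsUnit g := by
    intro g h hgh hu
    have h0 : g.coeff 0 * h.coeff 0 = -1 := by
      rw [← Polynomial.mul_coeff_zero, ← hgh]
      simp [Polynomial.coeff_X_pow, show ¬ 0 = D by omega]
    have hg0 : IsUnit (g.coeff 0) :=
      IsUnit.of_mul_eq_one (-h.coeff 0) (by rw [mul_neg, h0, neg_neg])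
    have ht : g.natTrailingDegree = 0 :=
      Polynomial.natTrailingDegree_eq_zero.2 (Or.inr hg0.ne_zero)
    have hn : g.natDegree = 0 := by
      rw [Polynomial.natDegree_eq_reverse_natDegree_add_natTrailingDegree, ht,
        Polynomial.natDegree_eq_zero_of_isUnit hu]
    rw [Polynomial.eq_C_of_natDegree_eq_zero hn]
    exact hg0.map Polynomial.C
  refine ⟨fun hu => ?_, fun g h hgh => ?_⟩
  · have := Polynomial.natDegree_eq_zero_of_isUnit hu
    omega
  · have h1 := hE'
    rw [hgh, Polynomial.reverse_mul_of_domain] at h1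
    rcases h1.isUnit_or_isUnit rfl with hu | hu
    · exact Or.inl (key g h hgh hu)
    · exact Or.inr (key h g (by rw [hgh, mul_comm]) hu)

/-- Let `F` be a field and `φ ∈ F[U,V]` a homogeneous polynomial of degree `≥ 1` that is
square-free.  Then `φ − 1` is irreducible in `F[U,V]`. -/
theorem homogeneous_squarefree_sub_one_irreducible (F : Type) [Field F]
    (φ : MvPolynomial (Fin 2) F) (D : ℕ) (hD : 1 ≤ D) (hhom : φ.IsHomogeneous D)
    (hsf : Squarefree φ) :
    Irreducible (φ - 1) := by
  have hnu : ¬ IsUnit φ := by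
    intro hu
    have h1 := hu.map (constantCoeff (R := F) (σ := Fin 2))
    rw [constantCoeff_eq, hhom.coeff_eq_zero (by simp; omega)] at h1
    exact not_isUnit_zero h1
  obtain ⟨p, hp, hpφ⟩ := WfDvdMonoid.exists_irreducible_factor hnu hsf.ne_zero
  have hirr := irreducible_C_mul_X_pow_sub_one φ p hp.prime hpφ
    (fun h => hp.not_isUnit (hsf p h)) D hD
  let s : MvPolynomial (Fin 2) F →ₐ[F] Polynomial (MvPolynomial (Fin 2) F) :=
    aeval (fun i => Polynomial.C (X i) * Polynomial.X)
  have hs : ∀ q, (s q).eval 1 = q := by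
    intro q
    induction q using MvPolynomial.induction_on with
    | C r => simp [s, Polynomial.algebraMap_apply, MvPolynomial.algebraMap_eq]
    | add f g hf hg => rw [map_add, Polynomial.eval_add, hf, hg]
    | mul_X f i hf => rw [map_mul, Polynomial.eval_mul, hf]; simp [s]
  have hmon : ∀ (d : Fin 2 →₀ ℕ) (c : F), s (monomial d c)
      = Polynomial.C (monomial d c) * Polynomial.X ^ d.degree := by
    intro d c
    simp only [s, aeval_monomial, Polynomial.algebraMap_apply, MvPolynomial.algebraMap_eq]
    rw [monomial_eq (s := d)]
    simp only [Finsupp.prod, mul_pow, Finset.prod_mul_distrib, Finset.prod_pow_eq_pow_sum,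
      Finsupp.degree_apply, map_mul, map_prod, map_pow, mul_assoc]
  have hsφ : s φ = Polynomial.C φ * Polynomial.X ^ D := by
    conv_lhs => rw [φ.as_sum]
    conv_rhs => rw [φ.as_sum]
    rw [map_sum, map_sum, Finset.sum_mul]
    refine Finset.sum_congr rfl fun d hd => ?_
    rw [hmon, hhom.degree_eq_sum_deg_support hd, Finsupp.degree_apply]
  have : IsLocalHom s := ⟨fun q hq => by
    have := hq.map (Polynomial.evalRingHom (1 : MvPolynomial (Fin 2) F))
    rwa [Polynomial.coe_evalRingHom, hs] at this⟩
  refine Irreducible.of_map (f := s) ?_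
  rw [map_sub, map_one, hsφ]
  exact hirr
end
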